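/- The determinant Φ_0^{a,b,N;M} of the a×a matrix whose rows are indexed by g = b,…,a+b−1 and columns by j = 1,…,a, with (g,j)-entry W_g^{a,b,N;M}(j−1), is nonzero. -/

import Mathlib

noncomputable section

open Finset

/-- Pochhammer symbol `(x)_m = x (x+1) ⋯ (x+m-1)`. -/
def poch (x : ℝ) (m : ℕ) : ℝ := ∏ i ∈ Finset.range m, (x + i)

/-- Complex Pochhammer symbol. -/
def pochC (x : ℂ) (m : ℕ) : ℂ := ∏ i ∈ Finset.range m, (x + i)

/-- `λ^{a,b}(x) = x (x + a + b + 1)`. -/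
def lam (a b : ℕ) (x : ℝ) : ℝ := x * (x + a + b + 1)

/-- Complex version of `λ^{a,b}`. -/
def lamC (a b : ℕ) (x : ℂ) : ℂ := x * (x + a + b + 1)

/-- Hahn polynomial `h_n^{α,β,ν}(x)`. -/
def hahn (α β ν : ℝ) (n : ℕ) (x : ℝ) : ℝ :=
  ∑ j ∈ Finset.range (n + 1),
    poch (-(n : ℝ)) j * poch (α + β + n + 1) j * poch (-ν + j) (n - j) *
      poch (α + j + 1) (n - j) * poch (-x) j / (Nat.factorial j : ℝ)

/-- Dual Hahn polynomial `R_n^{α,β,ν}(x)` for `n : ℕ`. -/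
def dualHahnNat (α β ν : ℝ) (n : ℕ) (x : ℝ) : ℝ :=
  ∑ j ∈ Finset.range (n + 1),
    poch (-(n : ℝ)) j * poch (-ν + j) (n - j) * poch (α + j + 1) (n - j) /
        ((Nat.factorial n : ℝ) * (-1) ^ j * (Nat.factorial j : ℝ)) *
      ∏ i ∈ Finset.range j, (x - i * (α + β + 1 + i))

/-- Dual Hahn polynomial with the convention `R_k ≡ 0` for `k < 0`. -/
def dualHahn (α β ν : ℝ) (k : ℤ) (x : ℝ) : ℝ :=
  if k < 0 then 0 else dualHahnNat α β ν k.toNat x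

/-- Complex dual Hahn polynomial. -/
def dualHahnNatC (α β ν : ℂ) (n : ℕ) (x : ℂ) : ℂ :=
  ∑ j ∈ Finset.range (n + 1),
    pochC (-(n : ℂ)) j * pochC (-ν + j) (n - j) * pochC (α + j + 1) (n - j) /
        ((Nat.factorial n : ℂ) * (-1) ^ j * (Nat.factorial j : ℂ)) *
      ∏ i ∈ Finset.range j, (x - i * (α + β + 1 + i))

/-- Complex dual Hahn polynomial with the convention `R_k ≡ 0` for `k < 0`. -/
def dualHahnC (α β ν : ℂ) (k : ℤ) (x : ℂ) : ℂ :=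
  if k < 0 then 0 else dualHahnNatC α β ν k.toNat x

/-- `⌈(a+b)/2⌉`. -/
def ceilHalf (a b : ℕ) : ℕ := (a + b + 1) / 2

/-- The auxiliary polynomials `W_g^{a,b,N;𝓜}(x)`; the third parameter is allowed to be any
real number (so that triples like `(a, b, -2-N-a-b)` can be used). -/
def W (a b : ℕ) (Nr : ℝ) (M : ℕ → ℝ) (g : ℕ) (x : ℝ) : ℝ :=
  if a ≤ g ∧ g ≤ a + b - 1 then
    (-1 : ℝ) ^ (b + g) * (Nat.factorial (g - b) : ℝ) *
      ((Nat.factorial (a + b - g - 1) : ℝ) * poch (-x) a *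
          hahn (a : ℝ) (-(b : ℝ)) (-2 - Nr - a) (g - a) (x - a) +
        (Nat.factorial (g - a) : ℝ) * poch (Nr + a + b + 1 - g) (2 * g - a - b + 1) / M (g - a) *
          hahn (-(a : ℝ)) (-(b : ℝ)) (-2 - Nr) (a + b - g - 1) x)
  else if ceilHalf a b ≤ g ∧ g + 1 ≤ a then
    deriv (fun s : ℝ =>
      hahn (-(a : ℝ) - s) (-(b : ℝ)) (-2 - Nr) g x -
        hahn (-(a : ℝ) - s) (-(b : ℝ)) (-2 - Nr) g 0 /
            hahn (-(a : ℝ) - s) (-(b : ℝ)) (-2 - Nr) (a + b - g - 1) 0 *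
          hahn (-(a : ℝ) - s) (-(b : ℝ)) (-2 - Nr) (a + b - g - 1) x) 0
  else hahn (-(a : ℝ)) (-(b : ℝ)) (-2 - Nr) g x

/-- The mass `ρ_{b,a,N}(x)` of the dual Hahn measure. -/
def rhoDH (a b N : ℕ) (x : ℕ) : ℝ :=
  (2 * (x : ℝ) + a + b + 1) * poch ((b : ℝ) + 1) x * poch (-(N : ℝ)) x * (Nat.factorial N : ℝ) /
    ((-1 : ℝ) ^ x * poch ((x : ℝ) + a + b + 1) (N + 1) * poch ((a : ℝ) + 1) x *
      (Nat.factorial x : ℝ))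

/-- The mass of the measure `ν_{a,b,N}^{𝓜}` at the point `λ^{a,b}(x)`, for `x = -b, …, N`. -/
def mass (a b N : ℕ) (M : ℕ → ℝ) (x : ℤ) : ℝ :=
  if x < 0 then
    (2 * (x : ℝ) + a + b + 1) * poch ((N : ℝ) + 1 - (x : ℝ)) (x + b).toNat /
        poch ((N : ℝ) + b + 1) (x + a + 1).toNat * M (x + b).toNat
  else
    (poch ((N : ℝ) + 1) b) ^ 2 / poch ((b : ℝ) + 1) (a - b) * rhoDH a b N x.toNat /
      ∏ i ∈ Finset.range b, (((x : ℝ) + a + i + 1) * ((x : ℝ) + b - i))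

/-- The pairing `⟨p, q⟩` with respect to `ν_{a,b,N}^{𝓜}`. -/
def pairing (a b N : ℕ) (M : ℕ → ℝ) (p q : ℝ → ℝ) : ℝ :=
  ∑ x ∈ Finset.Icc (-(b : ℤ)) (N : ℤ),
    mass a b N M x * p (lam a b (x : ℝ)) * q (lam a b (x : ℝ))

/-- The determinant `Φ_n^{a,b,N;𝓜}`. -/
def PhiM (a b N : ℕ) (M : ℕ → ℝ) (n : ℕ) : ℝ :=
  Matrix.det (Matrix.of fun i j : Fin a =>
    W a b (N : ℝ) M (b + (i : ℕ)) (-(n : ℝ) + ((j : ℕ) : ℝ)))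

/-- The polynomial `q_n^{a,b,N;𝓜}(x)` given by the determinantal formula. -/
def qM (a b N : ℕ) (M : ℕ → ℝ) (n : ℕ) (x : ℝ) : ℝ :=
  Matrix.det (Matrix.of fun i j : Fin (a + 1) =>
    if (i : ℕ) = 0 then
      (-1 : ℝ) ^ (j : ℕ) * dualHahn (a : ℝ) (b : ℝ) (N : ℝ) ((n : ℤ) - ((j : ℕ) : ℤ)) x /
        poch ((b : ℝ) + N - n + (j : ℕ) + 1) (a - (j : ℕ))
    else
      W a b (N : ℝ) M (b + (i : ℕ) - 1) (-(n : ℝ) + ((j : ℕ) : ℝ) - 1))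
theorem poch_ne_zero {x : ℝ} {m : ℕ} (h : ∀ i < m, x + (i : ℝ) ≠ 0) : poch x m ≠ 0 :=
  Finset.prod_ne_zero_iff.mpr fun i hi => h i (Finset.mem_range.mp hi)

theorem poch_pos {x : ℝ} (hx : 0 < x) (m : ℕ) : 0 < poch x m :=
  Finset.prod_pos fun _ _ => by positivity

@[simp] theorem poch_zero_right (x : ℝ) : poch x 0 = 1 := by simp [poch]

theorem poch_neg_natCast_eq_zero {n m : ℕ} (h : n < m) : poch (-(n : ℝ)) m = 0 :=
  Finset.prod_eq_zero (Finset.mem_range.mpr h) (by simp)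

theorem poch_neg_natCast_ne_zero {n m : ℕ} (h : m ≤ n) : poch (-(n : ℝ)) m ≠ 0 :=
  poch_ne_zero fun i hi h0 => by
    have : (i : ℝ) < n := by exact_mod_cast hi.trans_le h
    linarith

theorem differentiableAt_poch {f : ℝ → ℝ} {s : ℝ} (hf : DifferentiableAt ℝ f s) (m : ℕ) :
    DifferentiableAt ℝ (fun t => poch (f t) m) s := by
  unfold poch
  exact DifferentiableAt.fun_finsetProd fun i _ => hf.add_const _

/-- The coefficient of `(-x)_j` in the Hahn polynomial `h_n^{α,β,ν}(x)`. -/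
def hahnCoeff (α β ν : ℝ) (n j : ℕ) : ℝ :=
  poch (-(n : ℝ)) j * poch (α + β + n + 1) j * poch (-ν + j) (n - j) *
    poch (α + j + 1) (n - j) / (Nat.factorial j : ℝ)

theorem hahn_eq_sum (α β ν : ℝ) (n : ℕ) (x : ℝ) :
    hahn α β ν n x = ∑ j ∈ Finset.range (n + 1), hahnCoeff α β ν n j * poch (-x) j :=
  Finset.sum_congr rfl fun j _ => by unfold hahnCoeff; ring

theorem hahn_eq_sum_of_le (α β ν : ℝ) {n m : ℕ} (h : n ≤ m) (x : ℝ) :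
    hahn α β ν n x = ∑ j ∈ Finset.range (m + 1), hahnCoeff α β ν n j * poch (-x) j := by
  rw [hahn_eq_sum]
  refine Finset.sum_subset (Finset.range_subset_range.mpr (by omega)) fun j _ hj => ?_
  have : n < j := by simpa using hj
  simp [hahnCoeff, poch_neg_natCast_eq_zero this]

theorem hahn_zero (α β ν : ℝ) (n : ℕ) :
    hahn α β ν n 0 = poch (-ν) n * poch (α + 1) n := by
  rw [hahn_eq_sum, Finset.sum_eq_single 0]
  · simp [hahnCoeff]
  · intro j _ hj
    have := poch_neg_natCast_eq_zero (Nat.pos_of_ne_zero hj)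
    simp_all
  · simp

theorem differentiableAt_hahnCoeff {α : ℝ → ℝ} {s : ℝ} (hα : DifferentiableAt ℝ α s)
    (β ν : ℝ) (n j : ℕ) : DifferentiableAt ℝ (fun t => hahnCoeff (α t) β ν n j) s := by
  unfold hahnCoeff
  have h1 : DifferentiableAt ℝ (fun t => poch (α t + β + n + 1) j) s :=
    differentiableAt_poch (by fun_prop) j
  have h2 : DifferentiableAt ℝ (fun t => poch (α t + j + 1) (n - j)) s :=
    differentiableAt_poch (by fun_prop) (n - j)
  fun_prop

theorem differentiableAt_hahn {α : ℝ → ℝ} {s : ℝ} (hα : DifferentiableAt ℝ α s)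
    (β ν : ℝ) (n : ℕ) (x : ℝ) : DifferentiableAt ℝ (fun t => hahn (α t) β ν n x) s := by
  simp only [hahn_eq_sum]
  exact DifferentiableAt.fun_sum fun j _ => (differentiableAt_hahnCoeff hα β ν n j).mul_const _

/-- `f` is a polynomial of exact degree `n`, expanded in the basis `(-x)_j`. -/
def HasExactDegree (f : ℝ → ℝ) (n : ℕ) : Prop :=
  ∃ c : ℕ → ℝ, c n ≠ 0 ∧ ∀ x, f x = ∑ j ∈ Finset.range (n + 1), c j * poch (-x) j

theorem HasExactDegree.const_mul {f : ℝ → ℝ} {n : ℕ} (hf : HasExactDegree f n) {k : ℝ}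
    (hk : k ≠ 0) : HasExactDegree (fun x => k * f x) n := by
  obtain ⟨c, hc, h⟩ := hf
  refine ⟨fun j => k * c j, mul_ne_zero hk hc, fun x => ?_⟩
  simp only [h, Finset.mul_sum, mul_assoc]

/-- Polynomials of exact degrees `0, …, a - 1`, in any order, are linearly independent on the
points `0, …, a - 1`. -/
theorem det_ne_zero_of_hasExactDegree {a : ℕ} (f : Fin a → ℝ → ℝ) (σ : Equiv.Perm (Fin a))
    (hf : ∀ k, HasExactDegree (f (σ k)) k) :
    Matrix.det (Matrix.of fun i j : Fin a => f i (j : ℕ)) ≠ 0 := by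
  choose c hc hfc using hf
  set A : Matrix (Fin a) (Fin a) ℝ := Matrix.of fun i j : Fin a => f i (j : ℕ)
  let C : Matrix (Fin a) (Fin a) ℝ := Matrix.of fun k j => if j ≤ k then c k j else 0
  let L : Matrix (Fin a) (Fin a) ℝ := Matrix.of fun j x => poch (-((x : ℕ) : ℝ)) j
  have hCL : A.submatrix σ id = C * L := by
    ext k x
    simp only [Matrix.submatrix_apply, id, Matrix.mul_apply, A, C, L, Matrix.of_apply, hfc]
    simp only [Fin.le_def]
    rw [Fin.sum_univ_eq_sum_range
      (fun j => (if j ≤ (k : ℕ) then c k j else 0) * poch (-((x : ℕ) : ℝ)) j) a]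
    have hsub : Finset.range ((k : ℕ) + 1) ⊆ Finset.range a :=
      Finset.range_subset_range.mpr k.isLt
    rw [← Finset.sum_subset hsub]
    · exact Finset.sum_congr rfl fun j hj => by
        rw [if_pos (Nat.lt_succ_iff.mp (Finset.mem_range.mp hj))]
    · intro j _ hj
      rw [if_neg (by simpa [Nat.lt_succ_iff] using hj), zero_mul]
  have hC : C.det ≠ 0 := by
    have hT : C.IsLowerTriangular := fun i j hij => if_neg (not_le.mpr hij)
    rw [Matrix.det_of_isLowerTriangular C hT]
    exact Finset.prod_ne_zero_iff.mpr fun k _ => by simpa [C] using hc k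
  have hL : L.det ≠ 0 := by
    have hT : L.IsUpperTriangular := fun i j hij => poch_neg_natCast_eq_zero hij
    rw [Matrix.det_of_isUpperTriangular hT]
    exact Finset.prod_ne_zero_iff.mpr fun k _ => poch_neg_natCast_ne_zero le_rfl
  intro h
  have := Matrix.det_permute σ A
  rw [h, mul_zero] at this
  exact mul_ne_zero hC hL (by rw [← Matrix.det_mul, ← hCL]; exact this)

theorem hasExactDegree_hahn (α β ν : ℝ) (n : ℕ) (h : poch (α + β + n + 1) n ≠ 0) :
    HasExactDegree (hahn α β ν n) n :=
  ⟨hahnCoeff α β ν n, by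
    simpa [hahnCoeff, h, Nat.factorial_ne_zero] using poch_neg_natCast_ne_zero le_rfl,
    hahn_eq_sum α β ν n⟩

theorem hasExactDegree_hahn_neg {a b n : ℕ} (h : 2 * n < a + b) (ν : ℝ) :
    HasExactDegree (hahn (-(a : ℝ)) (-(b : ℝ)) ν n) n :=
  hasExactDegree_hahn _ _ _ _ <| poch_ne_zero fun i hi h0 => by
    have h1 : (n : ℝ) + 1 + i = a + b := by linarith
    have h2 : n + 1 + i = a + b := by exact_mod_cast h1
    omega

theorem deriv_poch_neg_natCast_sub_ne_zero {m n : ℕ} (h : m < n) :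
    deriv (fun s : ℝ => poch (-(m : ℝ) - s) n) 0 ≠ 0 := by
  have hfac : (fun s : ℝ => poch (-(m : ℝ) - s) n) =
      fun s => (-s) * ∏ i ∈ (Finset.range n).erase m, (-(m : ℝ) - s + i) := by
    funext s
    rw [poch, ← Finset.mul_prod_erase _ _ (Finset.mem_range.mpr h)]
    ring
  have hd : DifferentiableAt ℝ
      (fun s : ℝ => ∏ i ∈ (Finset.range n).erase m, (-(m : ℝ) - s + i)) 0 :=
    DifferentiableAt.fun_finsetProd fun i _ => by fun_prop
  have hne : ∏ i ∈ (Finset.range n).erase m, (-(m : ℝ) - 0 + i) ≠ 0 :=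
    Finset.prod_ne_zero_iff.mpr fun i hi h0 => by
      have : (i : ℝ) = m := by linarith
      exact (Finset.mem_erase.mp hi).1 (by exact_mod_cast this)
  rw [hfac, ((hasDerivAt_neg' (0 : ℝ)).fun_mul hd.hasDerivAt).deriv]
  simpa using hne

theorem hasExactDegree_deriv {a b g m : ℕ} (hm : g + m + 1 = a + b) (hmg : m < g) (hma : m < a)
    {ν : ℝ} (hν : ν < 0) :
    HasExactDegree (fun x => deriv (fun s : ℝ =>
      hahn (-(a : ℝ) - s) (-(b : ℝ)) ν g x -
        hahn (-(a : ℝ) - s) (-(b : ℝ)) ν g 0 / hahn (-(a : ℝ) - s) (-(b : ℝ)) ν m 0 *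
          hahn (-(a : ℝ) - s) (-(b : ℝ)) ν m x) 0) g := by
  have hα : DifferentiableAt ℝ (fun s : ℝ => -(a : ℝ) - s) 0 := by fun_prop
  set R : ℝ → ℝ := fun s =>
    hahn (-(a : ℝ) - s) (-(b : ℝ)) ν g 0 / hahn (-(a : ℝ) - s) (-(b : ℝ)) ν m 0 with hR
  have hRd : DifferentiableAt ℝ R 0 := by
    refine (differentiableAt_hahn hα _ ν g 0).div (differentiableAt_hahn hα _ ν m 0) ?_
    rw [hahn_zero]
    refine mul_ne_zero (poch_pos (by linarith) m).ne' (poch_ne_zero fun i hi h0 => ?_)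
    have h1 : (1 : ℝ) + i = a := by linarith
    have h2 : 1 + i = a := by exact_mod_cast h1
    omega
  let F : ℕ → ℝ → ℝ := fun j s => hahnCoeff (-(a : ℝ) - s) (-(b : ℝ)) ν g j -
    R s * hahnCoeff (-(a : ℝ) - s) (-(b : ℝ)) ν m j
  have hF : ∀ j, DifferentiableAt ℝ (F j) 0 := fun j =>
    (differentiableAt_hahnCoeff hα _ ν g j).fun_sub
      (hRd.fun_mul (differentiableAt_hahnCoeff hα _ ν m j))
  refine ⟨fun j => deriv (F j) 0, ?_, fun x => ?_⟩
  · have hcast : (g : ℝ) + m + 1 = a + b := by exact_mod_cast hm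
    have hFg : F g = fun s => poch (-(g : ℝ)) g / (Nat.factorial g : ℝ) *
        poch (-(m : ℝ) - s) g := by
      funext s
      have : -(a : ℝ) - s + -(b : ℝ) + g + 1 = -(m : ℝ) - s := by linarith
      simp only [F, hahnCoeff, poch_neg_natCast_eq_zero hmg, this, Nat.sub_self, poch_zero_right]
      ring
    change deriv (F g) 0 ≠ 0
    rw [hFg, deriv_const_mul _ (differentiableAt_poch (by fun_prop) g)]
    exact mul_ne_zero (div_ne_zero (poch_neg_natCast_ne_zero le_rfl)
      (Nat.cast_ne_zero.mpr g.factorial_ne_zero)) (deriv_poch_neg_natCast_sub_ne_zero hmg)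
  · have hsum : (fun s : ℝ => hahn (-(a : ℝ) - s) (-(b : ℝ)) ν g x -
        R s * hahn (-(a : ℝ) - s) (-(b : ℝ)) ν m x) =
        fun s => ∑ j ∈ Finset.range (g + 1), F j s * poch (-x) j := by
      funext s
      rw [hahn_eq_sum, hahn_eq_sum_of_le _ _ _ hmg.le, Finset.mul_sum, ← Finset.sum_sub_distrib]
      exact Finset.sum_congr rfl fun j _ => by simp only [F]; ring
    change deriv (fun s : ℝ => hahn (-(a : ℝ) - s) (-(b : ℝ)) ν g x -
      R s * hahn (-(a : ℝ) - s) (-(b : ℝ)) ν m x) 0 = _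
    rw [hsum, deriv_fun_sum fun j _ => (hF j).mul_const _]
    exact Finset.sum_congr rfl fun j _ => deriv_mul_const (hF j) _

/-- Below `a`, the polynomial `W_g` has exact degree `g`. -/
theorem hasExactDegree_W_of_lt {a b g : ℕ} {N : ℝ} (hN : 0 ≤ N) (M : ℕ → ℝ) (hbg : b ≤ g)
    (hga : g < a) : HasExactDegree (W a b N M g) g := by
  have h1 : ¬(a ≤ g ∧ g ≤ a + b - 1) := by omega
  by_cases h2 : ceilHalf a b ≤ g ∧ g + 1 ≤ a
  · have hc := h2.1
    unfold ceilHalf at hc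
    have := hasExactDegree_deriv (a := a) (b := b) (g := g) (m := a + b - g - 1) (ν := -2 - N)
      (by omega) (by omega) (by omega) (by linarith)
    convert this using 2
    rw [W, if_neg h1, if_pos h2]
  · have hg : 2 * g < a + b := by unfold ceilHalf at h2; omega
    convert hasExactDegree_hahn_neg hg (-2 - N) using 1
    funext x
    rw [W, if_neg h1, if_neg h2]

/-- On the points `0, …, a - 1`, the polynomial `W_g` with `g = a + b - 1 - k ≥ a` is a nonzero
multiple of the Hahn polynomial of degree `k`. -/
theorem W_natCast_eq_of_le {a b g k : ℕ} {N : ℝ} (hN : 0 ≤ N) {M : ℕ → ℝ}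
    (hM : M (g - a) ≠ 0) (hag : a ≤ g) (hk : g + k + 1 = a + b) :
    ∃ t : ℝ, t ≠ 0 ∧ ∀ x : ℕ, x < a →
      W a b N M g x = t * hahn (-(a : ℝ)) (-(b : ℝ)) (-2 - N) k x := by
  have hcast : (g : ℝ) + k + 1 = a + b := by exact_mod_cast hk
  refine ⟨(-1 : ℝ) ^ (b + g) * (Nat.factorial (g - b) : ℝ) * ((Nat.factorial (g - a) : ℝ) *
    poch (N + a + b + 1 - g) (2 * g - a - b + 1) / M (g - a)), ?_, fun x hx => ?_⟩
  · have hp := poch_pos (x := N + a + b + 1 - g) (by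
      have : (0 : ℝ) ≤ k := k.cast_nonneg
      linarith) (2 * g - a - b + 1)
    have := hp.ne'
    have := Nat.factorial_ne_zero
    simp_all
  · rw [W, if_pos (by omega), poch_neg_natCast_eq_zero hx, show a + b - g - 1 = k by omega]
    ring

/-- The determinant `Φ_0^{a,b,N;𝓜}` is nonzero. -/
theorem duran_Phi0_ne_zero (a b N : ℕ) (M : ℕ → ℝ)
    (hb : 1 ≤ b) (hba : b ≤ a) (haN : a ≤ N)
    (hM : ∀ i, i < b → M i ≠ 0 ∧ M i ≠ 1) :
    PhiM a b N M 0 ≠ 0 := by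
  let row : Fin a → Fin a := fun k =>
    if (k : ℕ) < b then ⟨a - 1 - k, by omega⟩ else ⟨k - b, by omega⟩
  have hrow : Function.Injective row := by
    intro k l hkl
    have := congrArg Fin.val hkl
    simp only [row] at this
    ext
    split_ifs at this <;> simp at this <;> omega
  let σ : Equiv.Perm (Fin a) := Equiv.ofBijective row (Finite.injective_iff_bijective.mp hrow)
  have key : ∀ i : Fin a, ∃ f : ℝ → ℝ, HasExactDegree f (σ.symm i : Fin a) ∧
      ∀ x : ℕ, x < a → W a b N M (b + i) x = f x := by
    intro i
    obtain ⟨k, rfl⟩ := σ.surjective i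
    rw [Equiv.symm_apply_apply]
    have hσ : ((σ k : Fin a) : ℕ) = if (k : ℕ) < b then a - 1 - k else k - b := by
      simp only [σ, row, Equiv.ofBijective_apply]
      split_ifs <;> rfl
    have hka := k.isLt
    by_cases hkb : (k : ℕ) < b
    · rw [if_pos hkb] at hσ
      rw [hσ]
      obtain ⟨t, ht, hW⟩ := W_natCast_eq_of_le (a := a) (b := b) (g := b + (a - 1 - k)) (k := k)
        (N := N) N.cast_nonneg (hM (b + (a - 1 - k) - a) (by omega)).1 (by omega) (by omega)
      exact ⟨_, (hasExactDegree_hahn_neg (by omega) _).const_mul ht, hW⟩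
    · rw [if_neg hkb] at hσ
      rw [hσ, show b + ((k : ℕ) - b) = k by omega]
      exact ⟨_, hasExactDegree_W_of_lt N.cast_nonneg M (by omega) hka, fun _ _ => rfl⟩
  choose f hf hW using key
  have hdet := det_ne_zero_of_hasExactDegree f σ fun k => by simpa using hf (σ k)
  unfold PhiM
  convert hdet using 5 with i j
  simpa using hW i j j.isLt
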